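/- arXiv:2402.14332 — 2 statements merged into one kernel-verified Lean document; each statement's English description precedes it below -/
import Mathlib

section
/- Let G = (V,E,w) be a weighted graph on n vertices with total edge weight W = Σ_{e∈E} w_e, and let S_t be a random subset of V in which each vertex is included independently with probability t/n. Then E_{S_t}[SDP(G[S_t])] ≤ (t/n)·SDP(G) − (t(n−t)/n²)·(W/2). -/
open scoped Classical
open Real Matrix

noncomputable section

/-- The Laplacian `L = D − A` of a weighted graph given by its weight matrix. -/
def lap {V : Type*} [Fintype V] (w : Matrix V V ℝ) : Matrix V V ℝ :=
  Matrix.of fun i j => if i = j then ∑ k, w i k else -(w i j)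

/-- The optimal value of the Goemans–Williamson SDP relaxation of max-cut:
`max (1/4)·Tr(L_G X)` over PSD matrices `X` with unit diagonal. -/
def sdpVal {V : Type*} [Fintype V] (w : Matrix V V ℝ) : ℝ :=
  sSup { v : ℝ | ∃ X : Matrix V V ℝ, X.PosSemidef ∧ (∀ i, X i i = 1) ∧
    v = (1 / 4) * (lap w * X).trace }

/-- The weight matrix of the vertex-induced subgraph `G[S]`. -/
def subw {n : ℕ} (w : Matrix (Fin n) (Fin n) ℝ) (S : Finset (Fin n)) :
    Matrix {i // i ∈ S} {i // i ∈ S} ℝ :=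
  Matrix.of fun i j => w i j

/-- The total edge weight `W = Σ_{(i,j)∈E} w_ij` (each undirected edge counted once). -/
def totalW {n : ℕ} (w : Matrix (Fin n) (Fin n) ℝ) : ℝ := (1 / 2) * ∑ i, ∑ j, w i j

/-- `E_{S_t}[SDP(G[S_t])]` where each vertex of `G` is kept independently with probability
`p`. -/
def esdp {n : ℕ} (w : Matrix (Fin n) (Fin n) ℝ) (p : ℝ) : ℝ :=
  ∑ S : Finset (Fin n), p ^ S.card * (1 - p) ^ (n - S.card) * sdpVal (subw w S)

/-- `G = (V,E,w)` is a weighted graph: symmetric nonnegative weights and no self-loops. -/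
def IsWeightedGraph {n : ℕ} (w : Matrix (Fin n) (Fin n) ℝ) : Prop :=
  (∀ i j, w i j = w j i) ∧ (∀ i j, 0 ≤ w i j) ∧ (∀ i, w i i = 0)

theorem trace_lap_mul {V : Type*} [Fintype V] (w X : Matrix V V ℝ) (hw : ∀ i, w i i = 0)
    (hX : ∀ i, X i i = 1) :
    (lap w * X).trace = ∑ i, ∑ j, w i j - (w * X).trace := by
  have h : lap w = Matrix.diagonal (fun i => ∑ k, w i k) - w := by
    ext i j
    by_cases hij : i = j
    · subst hij
      simp [lap, hw]
    · simp [lap, hij]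
  rw [h, Matrix.sub_mul, Matrix.trace_sub]
  simp [Matrix.trace, Matrix.diagonal_mul, hX]

theorem Matrix.PosSemidef.neg_one_le_apply {V : Type*} [Fintype V] {X : Matrix V V ℝ}
    (hX : X.PosSemidef) (h1 : ∀ i, X i i = 1) (i j : V) : -1 ≤ X i j := by
  have h := hX.dotProduct_mulVec_nonneg (Pi.single i 1 + Pi.single j 1)
  have hs : X j i = X i j := by simpa using hX.isHermitian.apply i j
  simp [Matrix.mulVec_add, add_dotProduct, dotProduct_add, h1, hs] at h
  linarith

theorem bddAbove_sdp_values {V : Type*} [Fintype V] (w : Matrix V V ℝ)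
    (h0 : ∀ i j, 0 ≤ w i j) (hw : ∀ i, w i i = 0) :
    BddAbove { v : ℝ | ∃ X : Matrix V V ℝ, X.PosSemidef ∧ (∀ i, X i i = 1) ∧
      v = (1 / 4) * (lap w * X).trace } := by
  refine ⟨(1 / 2) * ∑ i, ∑ j, w i j, ?_⟩
  rintro v ⟨X, hX, h1, rfl⟩
  have h : -∑ i, ∑ j, w i j ≤ (w * X).trace := by
    simp only [Matrix.trace, Matrix.diag_apply, Matrix.mul_apply, ← Finset.sum_neg_distrib]
    refine Finset.sum_le_sum fun i _ => Finset.sum_le_sum fun j _ => ?_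
    nlinarith [h0 i j, hX.neg_one_le_apply h1 j i]
  rw [trace_lap_mul w X hw h1]
  linarith

/-- The probability that a random subset of `Fin n`, keeping each element independently with
probability `p`, contains `A`. -/
theorem sum_subset_bernoulli {n : ℕ} (p : ℝ) (A : Finset (Fin n)) :
    ∑ S : Finset (Fin n), p ^ S.card * (1 - p) ^ (n - S.card) * (if A ⊆ S then 1 else 0)
      = p ^ A.card := by
  have h := Finset.prod_add (fun _ : Fin n => p) (fun i => if i ∈ A then 0 else 1 - p)
    Finset.univ
  have hl : ∏ i : Fin n, (p + if i ∈ A then 0 else 1 - p) = p ^ A.card := by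
    have : ∀ i : Fin n, (p + if i ∈ A then 0 else 1 - p) = if i ∈ A then p else 1 := by
      intro i; split_ifs <;> ring
    simp [this]
  rw [hl, Finset.powerset_univ] at h
  rw [h]
  refine Finset.sum_congr rfl fun S _ => ?_
  rw [Finset.prod_const, mul_assoc]
  congr 1
  by_cases hA : A ⊆ S
  · rw [if_pos hA, mul_one, Finset.prod_congr rfl (g := fun _ => 1 - p)]
    · simp [Finset.card_sdiff]
    · intro i hi
      rw [if_neg]
      intro hiA
      exact (Finset.mem_sdiff.1 hi).2 (hA hiA)
  · obtain ⟨i, hiA, hiS⟩ := Finset.not_subset.1 hA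
    rw [if_neg hA, mul_zero]
    exact (Finset.prod_eq_zero (i := i) (by simp [hiS]) (by simp [hiA])).symm

/-- Extension of a matrix indexed by `S` to all of `V`, by zero. -/
def zeroExtend {V : Type*} [Fintype V] (S : Finset V) (X : Matrix S S ℝ) : Matrix V V ℝ :=
  ((1 : Matrix V V ℝ).submatrix (Subtype.val : S → V) id)ᴴ * X *
    (1 : Matrix V V ℝ).submatrix (Subtype.val : S → V) id

theorem Matrix.PosSemidef.zeroExtend {V : Type*} [Fintype V] {S : Finset V} {X : Matrix S S ℝ}
    (hX : X.PosSemidef) : (zeroExtend S X).PosSemidef :=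
  hX.conjTranspose_mul_mul_same _

theorem zeroExtend_apply_self {V : Type*} [Fintype V] {S : Finset V} {X : Matrix S S ℝ}
    (hX : ∀ i, X i i = 1) (i : V) : zeroExtend S X i i = if i ∈ S then 1 else 0 := by
  simp only [zeroExtend, Matrix.mul_apply, Matrix.conjTranspose_apply, Matrix.submatrix_apply,
    Matrix.one_apply, id, star_trivial]
  split_ifs with h
  · rw [Finset.sum_eq_single ⟨i, h⟩, Finset.sum_eq_single ⟨i, h⟩]
    · simp [hX]
    · intro b _ hb
      rw [if_neg fun e => hb (Subtype.ext e), zero_mul]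
    · simp
    · intro b _ hb
      rw [if_neg fun e => hb (Subtype.ext e), mul_zero]
    · simp
  · refine Finset.sum_eq_zero fun b _ => ?_
    rw [if_neg, mul_zero]
    rintro rfl
    exact h b.2

theorem trace_mul_zeroExtend {V : Type*} [Fintype V] (w : Matrix V V ℝ) (S : Finset V)
    (X : Matrix S S ℝ) :
    (w * zeroExtend S X).trace = (w.submatrix (Subtype.val : S → V) Subtype.val * X).trace := by
  have h : w.submatrix (Subtype.val : S → V) Subtype.val =
      (1 : Matrix V V ℝ).submatrix (Subtype.val : S → V) id * w *
        ((1 : Matrix V V ℝ).submatrix (Subtype.val : S → V) id)ᴴ := by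
    ext i j
    simp [Matrix.mul_apply, Matrix.one_apply]
  rw [h, zeroExtend, ← Matrix.mul_assoc, ← Matrix.mul_assoc, Matrix.trace_mul_comm]
  simp only [Matrix.mul_assoc]

theorem sum_bernoulli_mul_sum_subw {n : ℕ} (w : Matrix (Fin n) (Fin n) ℝ)
    (hw : ∀ i, w i i = 0) (p : ℝ) :
    ∑ S : Finset (Fin n), p ^ S.card * (1 - p) ^ (n - S.card) * ∑ i, ∑ j, subw w S i j
      = p ^ 2 * ∑ i, ∑ j, w i j := by
  have h : ∀ S : Finset (Fin n), ∑ i, ∑ j, subw w S i j =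
      ∑ i, ∑ j, w i j * (if {i, j} ⊆ S then 1 else 0) := by
    intro S
    have e : ∀ i, ∑ j, w i j * (if {i, j} ⊆ S then (1 : ℝ) else 0) =
        if i ∈ S then ∑ j, (if j ∈ S then w i j else 0) else 0 := by
      intro i
      by_cases hi : i ∈ S <;> simp [Finset.insert_subset_iff, hi]
    simp only [e, subw, Matrix.of_apply]
    rw [← Finset.sum_filter, Finset.filter_mem_eq_inter, Finset.univ_inter,
      ← Finset.sum_coe_sort S]
    refine Finset.sum_congr rfl fun i _ => ?_
    rw [← Finset.sum_filter, Finset.filter_mem_eq_inter, Finset.univ_inter,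
      ← Finset.sum_coe_sort S]
  simp only [h, Finset.mul_sum]
  rw [Finset.sum_comm]
  refine Finset.sum_congr rfl fun i _ => ?_
  rw [Finset.sum_comm]
  refine Finset.sum_congr rfl fun j _ => ?_
  by_cases hij : i = j
  · simp [hij, hw]
  · rw [← Finset.card_pair hij, ← sum_subset_bernoulli, Finset.sum_mul]
    exact Finset.sum_congr rfl fun S _ => by ring

/-- The normalised average of the zero-extended SDP solutions of all induced subgraphs is
feasible for the whole graph. -/
theorem expected_sdp_value_le {n : ℕ} (w : Matrix (Fin n) (Fin n) ℝ) (hw : IsWeightedGraph w)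
    {p : ℝ} (hp : 0 < p) (hp1 : p ≤ 1) (X : ∀ S : Finset (Fin n), Matrix S S ℝ)
    (hX : ∀ S, (X S).PosSemidef) (h1 : ∀ S i, X S i i = 1) :
    ∑ S : Finset (Fin n), p ^ S.card * (1 - p) ^ (n - S.card) *
        ((1 / 4) * (lap (subw w S) * X S).trace) ≤
      p * sdpVal w - p * (1 - p) * (totalW w / 2) := by
  obtain ⟨-, h0, hd⟩ := hw
  let q : Finset (Fin n) → ℝ := fun S => p ^ S.card * (1 - p) ^ (n - S.card)
  have hq : ∀ S, 0 ≤ q S := fun S =>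
    mul_nonneg (pow_nonneg hp.le _) (pow_nonneg (sub_nonneg.2 hp1) _)
  let Z : Matrix (Fin n) (Fin n) ℝ := p⁻¹ • ∑ S, q S • zeroExtend S (X S)
  have hZ : Z.PosSemidef :=
    (Matrix.posSemidef_sum _ fun S _ => (hX S).zeroExtend.smul (hq S)).smul (inv_nonneg.2 hp.le)
  have hZ1 : ∀ i, Z i i = 1 := by
    intro i
    have h := sum_subset_bernoulli p {i}
    simp only [Finset.singleton_subset_iff, Finset.card_singleton, pow_one] at h
    simp only [Z, Matrix.smul_apply, Matrix.sum_apply, zeroExtend_apply_self (h1 _), smul_eq_mul,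
      q]
    refine (congrArg (p⁻¹ * ·) ?_).trans (inv_mul_cancel₀ hp.ne')
    convert h
  have hle : (1 / 4) * (lap w * Z).trace ≤ sdpVal w :=
    le_csSup (bddAbove_sdp_values w h0 hd) ⟨Z, hZ, hZ1, rfl⟩
  rw [trace_lap_mul w Z hd hZ1] at hle
  have htr : p * (w * Z).trace = ∑ S, q S * (subw w S * X S).trace := by
    simp only [Z, Matrix.mul_smul, Matrix.mul_sum, Matrix.trace_smul, Matrix.trace_sum,
      trace_mul_zeroExtend, smul_eq_mul]
    rw [mul_inv_cancel_left₀ hp.ne']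
    rfl
  have hsum := sum_bernoulli_mul_sum_subw w hd p
  have hlhs : ∑ S : Finset (Fin n), p ^ S.card * (1 - p) ^ (n - S.card) *
        ((1 / 4) * (lap (subw w S) * X S).trace) =
      (1 / 4) * (p ^ 2 * ∑ i, ∑ j, w i j - p * (w * Z).trace) := by
    rw [htr, ← hsum, ← Finset.sum_sub_distrib, Finset.mul_sum]
    refine Finset.sum_congr rfl fun S _ => ?_
    rw [trace_lap_mul (subw w S) (X S) (fun i => hd i) (h1 S)]
    ring
  rw [hlhs, totalW]
  nlinarith [mul_le_mul_of_nonneg_left hle hp.le]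

/-- For a weighted graph `G` on `n` vertices with total edge weight `W` and a
random subset `S_t` keeping each vertex independently with probability `t/n`,
`E[SDP(G[S_t])] ≤ (t/n)·SDP(G) − (t(n−t)/n²)·(W/2)`. -/
theorem stmt12 {n : ℕ} (hn : 0 < n) (w : Matrix (Fin n) (Fin n) ℝ)
    (hw : IsWeightedGraph w) (t : ℝ) (ht : 0 < t) (htn : t ≤ n) :
    esdp w (t / n) ≤
      (t / n) * sdpVal w - (t * ((n : ℝ) - t) / (n : ℝ) ^ 2) * (totalW w / 2) := by
  have hn' : (0 : ℝ) < n := Nat.cast_pos.2 hn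
  have hp : 0 < t / n := div_pos ht hn'
  have hp1 : t / n ≤ 1 := (div_le_one hn').2 htn
  have hcoef : t * ((n : ℝ) - t) / (n : ℝ) ^ 2 = t / n * (1 - t / n) := by
    field_simp
  rw [hcoef]
  refine le_of_forall_pos_le_add fun ε hε => ?_
  have hex : ∀ S : Finset (Fin n), ∃ X : Matrix S S ℝ, X.PosSemidef ∧ (∀ i, X i i = 1) ∧
      sdpVal (subw w S) - ε < (1 / 4) * (lap (subw w S) * X).trace := by
    intro S
    obtain ⟨v, ⟨X, hX, h1, rfl⟩, hv⟩ := exists_lt_of_lt_csSup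
      (s := { v : ℝ | ∃ X : Matrix S S ℝ, X.PosSemidef ∧ (∀ i, X i i = 1) ∧
        v = (1 / 4) * (lap (subw w S) * X).trace })
      ⟨_, 1, Matrix.PosSemidef.one, fun i => Matrix.one_apply_eq i, rfl⟩
      (sub_lt_self (sdpVal (subw w S)) hε)
    exact ⟨X, hX, h1, hv⟩
  choose X hX h1 hv using hex
  have htot := sum_subset_bernoulli (n := n) (t / n) ∅
  simp only [Finset.empty_subset, if_true, mul_one, Finset.card_empty, pow_zero] at htot
  refine le_trans ?_ (add_le_add_left (expected_sdp_value_le w hw hp hp1 X hX h1) ε)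
  calc esdp w (t / n)
      ≤ ∑ S : Finset (Fin n), (t / n) ^ S.card * (1 - t / n) ^ (n - S.card) *
          ((1 / 4) * (lap (subw w S) * X S).trace + ε) := by
        refine Finset.sum_le_sum fun S _ => mul_le_mul_of_nonneg_left (by linarith [hv S]) ?_
        exact mul_nonneg (pow_nonneg hp.le _) (pow_nonneg (sub_nonneg.2 hp1) _)
    _ = _ := by
        simp only [mul_add, Finset.sum_add_distrib, ← Finset.sum_mul, htot, one_mul]
end
end

section
/- Let G = (V,E,w) be a weighted graph on n vertices with total edge weight W, let X* be any optimal solution of the Goemans–Williamson SDP for G, and let S_t be a random subset of V in which each vertex is included independently with probability t/n. Set ε_SDP = ((n−t)/(n²t))·(SDP(G) − W/2). Then the expected Goemans–Williamson cut density on the full graph satisfies (0.878/t²)·E_{S_t}[SDP(G[S_t])] − 0.878·ε_SDP ≤ (1/n²)·E[Cut(round(X*);G)] ≤ (1/t²)·E_{S_t}[SDP(G[S_t])], where the middle expectation is over the Gaussian rounding randomness. -/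
open scoped Classical
open Real Matrix

noncomputable section

/-- The expected cut value of Goemans–Williamson hyperplane rounding applied to a feasible SDP
solution `X` on the weighted graph `w`: `E[Cut(round(X);G)] = Σ_{(i,j)∈E} w_ij·arccos(X_ij)/π`
(each undirected edge counted once). -/
def ecut {V : Type*} [Fintype V] (w X : Matrix V V ℝ) : ℝ :=
  (1 / 2) * ∑ i, ∑ j, w i j * (Real.arccos (X i j) / Real.pi)

theorem posSemidef_iff_symm_and_sum_nonneg {V : Type*} [Fintype V] {X : Matrix V V ℝ} :
    X.PosSemidef ↔ (∀ i j, X i j = X j i) ∧ ∀ c : V → ℝ, 0 ≤ ∑ i, ∑ j, c i * c j * X i j := by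
  have key : ∀ c : V → ℝ, star c ⬝ᵥ (X *ᵥ c) = ∑ i, ∑ j, c i * c j * X i j := by
    intro c
    simp only [dotProduct, mulVec, Finset.mul_sum, Pi.star_apply, star_trivial]
    exact Finset.sum_congr rfl fun i _ => Finset.sum_congr rfl fun j _ => by ring
  rw [Matrix.posSemidef_iff_dotProduct_mulVec]
  simp only [key]
  refine and_congr_left fun _ => ⟨fun h i j => by simpa using h.apply j i, fun h => ?_⟩
  ext i j
  simpa using h j i

theorem Matrix.PosSemidef.real_symm {V : Type*} [Fintype V] {X : Matrix V V ℝ}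
    (hX : X.PosSemidef) (i j : V) : X i j = X j i :=
  (posSemidef_iff_symm_and_sum_nonneg.1 hX).1 i j

theorem Matrix.PosSemidef.abs_apply_le_one {V : Type*} [Fintype V] {X : Matrix V V ℝ}
    (hX : X.PosSemidef) (hd : ∀ i, X i i = 1) (i j : V) : |X i j| ≤ 1 := by
  rcases eq_or_ne i j with rfl | hij
  · simp [hd]
  have h := (posSemidef_iff_symm_and_sum_nonneg.1 hX).2
  have key : ∀ s : ℝ, 0 ≤ 1 + s * X i j + s * X j i + s * s := by
    intro s
    have := h (fun k => if k = i then 1 else if k = j then s else 0)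
    have e : ∀ f : V → ℝ, ∑ k, (if k = i then 1 else if k = j then s else 0) * f k
        = f i + s * f j := by
      intro f
      rw [Fintype.sum_eq_add i j hij]
      · simp [hij.symm]
      · rintro k ⟨h1, h2⟩
        simp [h1, h2]
    simp only [mul_assoc, ← Finset.mul_sum] at this
    rw [e] at this
    simp only [e, hd] at this
    linarith
  have h1 := key 1
  have h2 := key (-1)
  rw [hX.real_symm j i] at h1 h2
  exact abs_le.2 ⟨by linarith, by linarith⟩

theorem quarter_trace_lap_mul {V : Type*} [Fintype V] {w X : Matrix V V ℝ}
    (hw : ∀ i, w i i = 0) (hX : X.PosSemidef) (hd : ∀ i, X i i = 1) :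
    (1 / 4) * (lap w * X).trace = ∑ i, ∑ j, w i j * (1 - X i j) / 4 := by
  rw [Matrix.trace, Finset.mul_sum]
  refine Finset.sum_congr rfl fun i _ => ?_
  have e : ∀ j, lap w i j * X j i = (if i = j then ∑ k, w i k else 0) - w i j * X i j := by
    intro j
    rw [hX.real_symm j i]
    by_cases h : i = j
    · subst h
      simp [lap, hd, hw]
    · simp [lap, h]
  rw [Matrix.diag_apply, Matrix.mul_apply, Finset.sum_congr rfl fun j _ => e j,
    Finset.sum_sub_distrib]
  simp only [Finset.sum_ite_eq, Finset.mem_univ, if_true, ← Finset.sum_sub_distrib, Finset.mul_sum]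
  exact Finset.sum_congr rfl fun j _ => by ring

theorem cut_value_le_sdpVal {V : Type*} [Fintype V] {w X : Matrix V V ℝ}
    (hw0 : ∀ i j, 0 ≤ w i j) (hw : ∀ i, w i i = 0) (hX : X.PosSemidef) (hd : ∀ i, X i i = 1) :
    ∑ i, ∑ j, w i j * (1 - X i j) / 4 ≤ sdpVal w := by
  refine le_csSup ⟨∑ i, ∑ j, w i j * (1 - (-1)) / 4, ?_⟩
    ⟨X, hX, hd, (quarter_trace_lap_mul hw hX hd).symm⟩
  rintro v ⟨Y, hY, hYd, rfl⟩
  rw [quarter_trace_lap_mul hw hY hYd]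
  gcongr with i _ j _
  · exact hw0 i j
  · exact (abs_le.1 (hY.abs_apply_le_one hYd i j)).1

theorem exists_feasible_sdpVal_sub_lt {V : Type*} [Fintype V] {w : Matrix V V ℝ}
    (hw : ∀ i, w i i = 0) {ε : ℝ} (hε : 0 < ε) :
    ∃ X : Matrix V V ℝ, X.PosSemidef ∧ (∀ i, X i i = 1) ∧
      sdpVal w - ε < ∑ i, ∑ j, w i j * (1 - X i j) / 4 := by
  obtain ⟨v, ⟨X, hX, hd, rfl⟩, hv⟩ := exists_lt_of_lt_csSup
    (⟨_, 1, Matrix.PosSemidef.one, fun i => Matrix.one_apply_eq i, rfl⟩ :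
      { v : ℝ | ∃ X : Matrix V V ℝ, X.PosSemidef ∧ (∀ i, X i i = 1) ∧
        v = (1 / 4) * (lap w * X).trace }.Nonempty) (sub_lt_self (sdpVal w) hε)
  exact ⟨X, hX, hd, by rwa [quarter_trace_lap_mul hw hX hd] at hv⟩

theorem sum_bernoulli_superset {n : ℕ} (p : ℝ) (T : Finset (Fin n)) :
    ∑ S : Finset (Fin n), p ^ S.card * (1 - p) ^ (n - S.card) * (if T ⊆ S then 1 else 0)
      = p ^ T.card := by
  have h := Fintype.prod_add (fun _ : Fin n => p) (fun i => if i ∈ T then 0 else 1 - p)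
  have e : ∏ i : Fin n, (p + if i ∈ T then 0 else 1 - p) = p ^ T.card := by
    rw [← Finset.prod_const, ← Finset.prod_subset (Finset.subset_univ T)
      (f := fun i => p + if i ∈ T then 0 else 1 - p)]
    · exact Finset.prod_congr rfl fun i hi => by simp [hi]
    · intro i _ hi
      simp [hi]
  rw [← e, h]
  refine Finset.sum_congr rfl fun S _ => ?_
  rw [Finset.prod_const, mul_assoc]
  congr 1
  split_ifs with hT
  · have : ∀ i ∈ Sᶜ, (if i ∈ T then 0 else 1 - p) = 1 - p := by
      intro i hi
      rw [if_neg fun h => Finset.mem_compl.1 hi (hT h)]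
    rw [Finset.prod_congr rfl this, Finset.prod_const, Finset.card_compl, Fintype.card_fin, mul_one]
  · obtain ⟨i, hiT, hiS⟩ := Finset.not_subset.1 hT
    rw [mul_zero, Finset.prod_eq_zero (Finset.mem_compl.2 hiS)]
    simp [hiT]

/-- Extension by zero of a matrix indexed by a finite subset. -/
def padZero {V : Type*} {S : Finset V} (Z : Matrix {i // i ∈ S} {i // i ∈ S} ℝ) : Matrix V V ℝ :=
  Matrix.of fun i j => if h : i ∈ S ∧ j ∈ S then Z ⟨i, h.1⟩ ⟨j, h.2⟩ else 0

theorem sum_mul_padZero {V : Type*} [Fintype V] {S : Finset V}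
    (Z : Matrix {i // i ∈ S} {i // i ∈ S} ℝ) (G : V → V → ℝ) :
    ∑ i, ∑ j, G i j * padZero Z i j = ∑ a : {i // i ∈ S}, ∑ b : {i // i ∈ S}, G a b * Z a b := by
  have e1 : ∀ i, ∑ j, G i j * padZero Z i j
      = ∑ b : {i // i ∈ S}, G i b * padZero Z i b := by
    intro i
    rw [Finset.sum_coe_sort S fun j => G i j * padZero Z i j]
    refine (Finset.sum_subset (Finset.subset_univ S) fun j _ hj => ?_).symm
    simp [padZero, hj]
  simp only [e1]
  have e2 := Finset.sum_coe_sort S fun i => ∑ b : {i // i ∈ S}, G i b * padZero Z i b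
  rw [Finset.sum_subset (Finset.subset_univ S)] at e2
  · rw [← e2]
    simp [padZero]
  · intro i _ hi
    simp [padZero, hi]

theorem posSemidef_padZero {V : Type*} [Fintype V] {S : Finset V}
    {Z : Matrix {i // i ∈ S} {i // i ∈ S} ℝ} (hZ : Z.PosSemidef) : (padZero Z).PosSemidef := by
  rw [posSemidef_iff_symm_and_sum_nonneg] at hZ ⊢
  refine ⟨fun i j => ?_, fun c => ?_⟩
  · by_cases hi : i ∈ S <;> by_cases hj : j ∈ S <;> simp [padZero, hi, hj, hZ.1 ⟨i, _⟩ ⟨j, _⟩]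
  · rw [sum_mul_padZero Z fun i j => c i * c j]
    exact hZ.2 fun a => c a

theorem sum_bernoulli_induced {n : ℕ} (p : ℝ) {w : Matrix (Fin n) (Fin n) ℝ}
    (hw : ∀ i, w i i = 0) (X : Matrix (Fin n) (Fin n) ℝ) :
    ∑ S : Finset (Fin n), p ^ S.card * (1 - p) ^ (n - S.card) *
        (∑ a : {i // i ∈ S}, ∑ b : {i // i ∈ S}, w a b * X a b)
      = p ^ 2 * ∑ i, ∑ j, w i j * X i j := by
  have e : ∀ S : Finset (Fin n), ∑ a : {i // i ∈ S}, ∑ b : {i // i ∈ S}, w a b * X a b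
      = ∑ i, ∑ j, w i j * X i j * (if {i, j} ⊆ S then 1 else 0) := by
    intro S
    refine (sum_mul_padZero (Matrix.of fun a b : {i // i ∈ S} => X a b)
      fun i j => w i j).symm.trans ?_
    refine Finset.sum_congr rfl fun i _ => Finset.sum_congr rfl fun j _ => ?_
    by_cases hi : i ∈ S <;> by_cases hj : j ∈ S <;>
      simp [padZero, hi, hj, Finset.insert_subset_iff]
  simp only [e, Finset.mul_sum]
  rw [Finset.sum_comm]
  refine Finset.sum_congr rfl fun i _ => ?_
  rw [Finset.sum_comm]
  refine Finset.sum_congr rfl fun j _ => ?_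
  rcases eq_or_ne i j with rfl | hij
  · simp [hw]
  · have := sum_bernoulli_superset p {i, j}
    rw [Finset.card_pair hij] at this
    rw [← this, Finset.sum_mul]
    exact Finset.sum_congr rfl fun S _ => by ring

theorem sq_mul_sdpVal_le_esdp {n : ℕ} {w : Matrix (Fin n) (Fin n) ℝ} (hw : IsWeightedGraph w)
    {p : ℝ} (hp0 : 0 ≤ p) (hp1 : p ≤ 1) {X : Matrix (Fin n) (Fin n) ℝ} (hX : X.PosSemidef)
    (hd : ∀ i, X i i = 1) (hopt : (1 / 4) * (lap w * X).trace = sdpVal w) :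
    p ^ 2 * sdpVal w ≤ esdp w p := by
  obtain ⟨-, hw0, hwd⟩ := hw
  have h1 := sum_bernoulli_induced p hwd (Matrix.of fun i j => (1 - X i j) / 4)
  rw [← hopt, quarter_trace_lap_mul hwd hX hd]
  simp only [Matrix.of_apply, ← mul_div_assoc] at h1
  rw [← h1, esdp]
  have hq : 0 ≤ 1 - p := by linarith
  gcongr with S _
  exact cut_value_le_sdpVal (w := subw w S) (X := X.submatrix (fun a => a.1) fun a => a.1)
    (fun i j => hw0 i j) (fun i => hwd i) (hX.submatrix _) (fun i => hd i)

theorem esdp_le {n : ℕ} {w : Matrix (Fin n) (Fin n) ℝ} (hw : IsWeightedGraph w)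
    {p : ℝ} (hp0 : 0 < p) (hp1 : p ≤ 1) :
    esdp w p ≤ p * sdpVal w - p * (1 - p) * (totalW w / 2) := by
  obtain ⟨-, hw0, hwd⟩ := hw
  have hq : 0 ≤ 1 - p := by linarith
  refine le_of_forall_pos_le_add fun ε hε => ?_
  choose Z hZ hZd hZv using fun S : Finset (Fin n) =>
    exists_feasible_sdpVal_sub_lt (w := subw w S) (fun i => hwd i) hε
  have hZv' : ∀ S : Finset (Fin n), sdpVal (subw w S) - ε ≤
      (∑ a : {i // i ∈ S}, ∑ b : {i // i ∈ S}, w a b) / 4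
        - (∑ a : {i // i ∈ S}, ∑ b : {i // i ∈ S}, w a b * Z S a b) / 4 := by
    intro S
    refine (hZv S).le.trans_eq ?_
    simp only [Finset.sum_div, ← Finset.sum_sub_distrib]
    refine Finset.sum_congr rfl fun a _ => Finset.sum_congr rfl fun b _ => ?_
    simp only [subw, Matrix.of_apply]
    ring
  set μ : Finset (Fin n) → ℝ := fun S => p ^ S.card * (1 - p) ^ (n - S.card) with hμ
  have hμ0 : ∀ S, 0 ≤ μ S := fun S => by positivity
  have hμ1 : ∑ S, μ S = 1 := by simpa using sum_bernoulli_superset p (∅ : Finset (Fin n))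
  have hμi : ∀ i, ∑ S, μ S * (if i ∈ S then 1 else 0) = p := fun i => by
    simpa using sum_bernoulli_superset p ({i} : Finset (Fin n))
  have hμw : ∑ S, μ S * (∑ a : {i // i ∈ S}, ∑ b : {i // i ∈ S}, w a b)
      = p ^ 2 * ∑ i, ∑ j, w i j := by
    simpa using sum_bernoulli_induced p hwd (Matrix.of fun _ _ => 1)
  have hfeas := cut_value_le_sdpVal (X := ∑ S, (μ S / p) • padZero (Z S)) hw0 hwd
    (Matrix.posSemidef_sum _ fun S _ => (posSemidef_padZero (hZ S)).smul (by
      have := hμ0 S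
      positivity))
    (fun i => by
      rw [Matrix.sum_apply, ← mul_right_inj' hp0.ne', mul_one, Finset.mul_sum]
      refine Eq.trans (Finset.sum_congr rfl fun S _ => ?_) (hμi i)
      by_cases hi : i ∈ S
      · simp [padZero, hi, hZd]
        field_simp
      · simp [padZero, hi])
  have hval : ∑ i, ∑ j, w i j * (1 - (∑ S, (μ S / p) • padZero (Z S)) i j) / 4
      = (∑ i, ∑ j, w i j) / 4
        - (∑ S, μ S * ∑ a : {i // i ∈ S}, ∑ b : {i // i ∈ S}, w a b * Z S a b) / (4 * p) := by
    simp only [← sum_mul_padZero (Z _) fun i j => w i j, Finset.mul_sum]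
    rw [Finset.sum_comm (s := (Finset.univ : Finset (Finset (Fin n)))), Finset.sum_div,
      Finset.sum_div, ← Finset.sum_sub_distrib]
    refine Finset.sum_congr rfl fun i _ => ?_
    rw [Finset.sum_comm (s := (Finset.univ : Finset (Finset (Fin n)))), Finset.sum_div,
      Finset.sum_div, ← Finset.sum_sub_distrib]
    refine Finset.sum_congr rfl fun j _ => ?_
    rw [Matrix.sum_apply, mul_sub, mul_one, sub_div, Finset.mul_sum, Finset.sum_div,
      Finset.sum_div]
    congr 1
    refine Finset.sum_congr rfl fun S _ => ?_
    simp only [Matrix.smul_apply, smul_eq_mul]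
    field_simp
  rw [hval] at hfeas
  have hE : esdp w p - ε ≤ (p ^ 2 * ∑ i, ∑ j, w i j) / 4
      - (∑ S, μ S * ∑ a : {i // i ∈ S}, ∑ b : {i // i ∈ S}, w a b * Z S a b) / 4 := by
    rw [← hμw, Finset.sum_div, Finset.sum_div, ← Finset.sum_sub_distrib]
    calc esdp w p - ε = ∑ S, μ S * (sdpVal (subw w S) - ε) := by
          simp only [mul_sub, Finset.sum_sub_distrib, ← Finset.sum_mul, hμ1, one_mul]
          rfl
      _ ≤ _ := Finset.sum_le_sum fun S _ =>
          (mul_le_mul_of_nonneg_left (hZv' S) (hμ0 S)).trans_eq (by ring)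
  have hfeas' := mul_le_mul_of_nonneg_left hfeas hp0.le
  have hcancel : ∀ A B : ℝ, p * (A / 4 - B / (4 * p)) = p * A / 4 - B / 4 := fun A B => by
    field_simp
  rw [hcancel] at hfeas'
  rw [totalW]
  nlinarith

theorem one_sub_cos_le {θ : ℝ} (h0 : 0 ≤ θ) (hπ : θ ≤ π) : 0.439 * (1 - cos θ) ≤ θ / π := by
  have hπ1 := Real.pi_gt_d4
  have hπ2 := Real.pi_lt_d4
  rw [le_div_iff₀ Real.pi_pos]
  by_cases hsmall : θ ≤ 1.45
  · have := Real.one_sub_sq_div_two_le_cos (x := θ)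
    nlinarith
  push Not at hsmall
  obtain ⟨δ, rfl⟩ : ∃ δ, θ = π - π / 4 - δ := ⟨π - π / 4 - θ, by ring⟩
  have hcos : cos (π - π / 4 - δ) = √2 / 2 * (sin δ - cos δ) := by
    rw [show π - π / 4 - δ = π - (π / 4 + δ) by ring, Real.cos_pi_sub, Real.cos_add,
      Real.cos_pi_div_four, Real.sin_pi_div_four]
    ring
  have hr1 : (1.4142 : ℝ) ≤ √2 := Real.le_sqrt_of_sq_le (by norm_num)
  have hr2 : √2 ≤ (1.41422 : ℝ) := Real.sqrt_le_iff.2 ⟨by norm_num, by norm_num⟩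
  rw [hcos]
  have key : √2 / 2 * (cos δ - sin δ) ≤ 0.7084 - 0.7251 * δ := by
    rcases le_or_gt δ 0 with hδ | hδ
    · have h1 := Real.cos_le_one δ
      have h2 : -δ ≥ - sin δ := by
        have := Real.sin_le (x := -δ) (by linarith)
        rw [Real.sin_neg] at this
        linarith
      calc √2 / 2 * (cos δ - sin δ) ≤ √2 / 2 * (1 - δ) := by gcongr; linarith
        _ ≤ 0.7084 - 0.7251 * δ := by nlinarith
    · have hδ1 : δ ≤ 0.91 := by linarith
      have h1 := (abs_le.1 (Real.cos_bound (x := δ) (by rw [abs_of_pos hδ]; linarith))).2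
      rw [abs_of_pos hδ] at h1
      have h2 := Real.sin_ge_sub_cube hδ.le
      set q := 1 - δ - δ ^ 2 / 2 + δ ^ 3 / 6 + δ ^ 4 * (5 / 96) with hq
      have h3 : cos δ - sin δ ≤ q := by linarith
      have h4 : √2 / 2 * (cos δ - sin δ) ≤ √2 / 2 * q := by gcongr
      have h5 : δ ^ 3 ≤ 0.91 * δ ^ 2 := by nlinarith [sq_nonneg δ]
      have h6 : δ ^ 4 ≤ 0.8281 * δ ^ 2 := by nlinarith [sq_nonneg δ]
      have h7 := sq_nonneg (δ - 0.04)
      rcases le_total 0 q with hq0 | hq0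
      · have : √2 / 2 * q ≤ 0.70711 * q := by gcongr; linarith
        linarith
      · have : √2 / 2 * q ≤ 0.7071 * q := mul_le_mul_of_nonpos_right (by linarith) hq0
        linarith
  nlinarith

theorem exists_hasSum_one_div_sqrt_one_sub : ∃ a : ℕ → ℝ, (∀ k, 0 ≤ a k) ∧
    ∀ u : ℝ, |u| < 1 → HasSum (fun k => a k * u ^ k) (1 / √(1 - u)) := by
  refine ⟨fun k => Ring.choose ((1 / 2 : ℝ) + k - 1) k, fun k => ?_, fun u hu => ?_⟩
  · have h := Ring.factorial_nsmul_multichoose_eq_ascPochhammer (1 / 2 : ℝ) k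
    rw [Polynomial.ascPochhammer_smeval_eq_eval, nsmul_eq_mul] at h
    beta_reduce
    rw [← Ring.multichoose_eq]
    have h2 := ascPochhammer_pos k (1 / 2 : ℝ) (by norm_num)
    rw [← h] at h2
    exact (pos_of_mul_pos_right h2 (by positivity)).le
  · have h := (Real.one_div_one_sub_rpow_hasFPowerSeriesOnBall_zero (1 / 2)).hasSum (y := u)
      (by simpa [enorm_eq_nnnorm, ← NNReal.coe_lt_coe] using hu)
    simpa [Real.sqrt_eq_rpow, mul_comm] using h

theorem posSemidef_map_pow {V : Type*} [Fintype V] {X : Matrix V V ℝ} (hX : X.PosSemidef)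
    (k : ℕ) : (X.map fun x => x ^ (k + 1)).PosSemidef := by
  induction k with
  | zero => simpa using hX
  | succ k ih =>
    have e : (X.map fun x => x ^ (k + 1 + 1)) = (X.map fun x => x ^ (k + 1)) ⊙ X := by
      ext i j
      simp [pow_succ]
    rw [e]
    exact ih.hadamard hX

theorem posSemidef_map_arcsin {V : Type*} [Fintype V] {X : Matrix V V ℝ} (hX : X.PosSemidef)
    (hd : ∀ i, X i i = 1) : (X.map arcsin).PosSemidef := by
  have habs := hX.abs_apply_le_one hd
  rw [posSemidef_iff_symm_and_sum_nonneg]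
  refine ⟨fun i j => by simp [hX.real_symm i j], fun c => ?_⟩
  obtain ⟨a, ha, hsum⟩ := exists_hasSum_one_div_sqrt_one_sub
  have hlt : ∀ s ∈ Set.Ioo (0 : ℝ) 1, ∀ i j, |s * X i j| < 1 := by
    intro s hs i j
    rw [abs_mul, abs_of_pos hs.1]
    nlinarith [habs i j, hs.1, hs.2, abs_nonneg (X i j)]
  have hderiv : ∀ s ∈ Set.Ioo (0 : ℝ) 1,
      HasDerivAt (fun s => ∑ i, ∑ j, c i * c j * arcsin (s * X i j))
        (∑ i, ∑ j, c i * c j * (1 / √(1 - (s * X i j) ^ 2) * X i j)) s := by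
    intro s hs
    refine HasDerivAt.fun_sum fun i _ => HasDerivAt.fun_sum fun j _ => HasDerivAt.const_mul _ ?_
    have h := abs_lt.1 (hlt s hs i j)
    exact (Real.hasDerivAt_arcsin h.1.ne' h.2.ne).comp s (hasDerivAt_mul_const (X i j))
  have hnonneg : ∀ s ∈ Set.Ioo (0 : ℝ) 1,
      0 ≤ ∑ i, ∑ j, c i * c j * (1 / √(1 - (s * X i j) ^ 2) * X i j) := by
    intro s hs
    have hs' : HasSum
        (fun k => ∑ i, ∑ j, c i * c j * (a k * ((s * X i j) ^ 2) ^ k * X i j))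
        (∑ i, ∑ j, c i * c j * (1 / √(1 - (s * X i j) ^ 2) * X i j)) :=
      hasSum_sum fun i _ => hasSum_sum fun j _ =>
        ((hsum _ (by
          rw [abs_pow]
          exact pow_lt_one₀ (abs_nonneg _) (hlt s hs i j) two_ne_zero)).mul_right _).mul_left _
    refine hs'.nonneg fun k => ?_
    have h := (posSemidef_iff_symm_and_sum_nonneg.1 (posSemidef_map_pow hX (2 * k))).2 c
    have := mul_nonneg (mul_nonneg (ha k) (pow_nonneg hs.1.le (2 * k))) h
    rw [Finset.mul_sum] at this
    refine this.trans_eq (Finset.sum_congr rfl fun i _ => ?_)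
    rw [Finset.mul_sum]
    refine Finset.sum_congr rfl fun j _ => ?_
    simp only [Matrix.map_apply]
    ring
  have hmono : MonotoneOn (fun s => ∑ i, ∑ j, c i * c j * arcsin (s * X i j))
      (Set.Icc 0 1) := by
    refine monotoneOn_of_deriv_nonneg (convex_Icc 0 1) ?_ ?_ ?_
    · refine Continuous.continuousOn ?_
      have := Real.continuous_arcsin
      fun_prop
    · rw [interior_Icc]
      exact fun s hs => (hderiv s hs).differentiableAt.differentiableWithinAt
    · rw [interior_Icc]
      intro s hs
      rw [(hderiv s hs).deriv]
      exact hnonneg s hs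
  simpa using hmono (Set.left_mem_Icc.2 zero_le_one) (Set.right_mem_Icc.2 zero_le_one) zero_le_one

theorem ecut_le_sdpVal {V : Type*} [Fintype V] {w X : Matrix V V ℝ}
    (hw0 : ∀ i j, 0 ≤ w i j) (hw : ∀ i, w i i = 0) (hX : X.PosSemidef) (hd : ∀ i, X i i = 1) :
    ecut w X ≤ sdpVal w := by
  have hπ := Real.pi_pos
  have h := cut_value_le_sdpVal (X := (2 / π) • X.map arcsin) hw0 hw
    ((posSemidef_map_arcsin hX hd).smul (by positivity)) (fun i => by
      simp [hd])
  refine Eq.trans_le ?_ h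
  simp only [ecut, Finset.mul_sum, Real.arccos, Matrix.smul_apply, Matrix.map_apply, smul_eq_mul]
  refine Finset.sum_congr rfl fun i _ => Finset.sum_congr rfl fun j _ => ?_
  field_simp
  ring

theorem cut_value_le_ecut {V : Type*} [Fintype V] {w X : Matrix V V ℝ}
    (hw0 : ∀ i j, 0 ≤ w i j) (hX : X.PosSemidef) (hd : ∀ i, X i i = 1) :
    0.878 * ∑ i, ∑ j, w i j * (1 - X i j) / 4 ≤ ecut w X := by
  simp only [ecut, Finset.mul_sum]
  refine Finset.sum_le_sum fun i _ => Finset.sum_le_sum fun j _ => ?_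
  have hx := abs_le.1 (hX.abs_apply_le_one hd i j)
  have h := one_sub_cos_le (Real.arccos_nonneg (X i j)) (Real.arccos_le_pi _)
  rw [Real.cos_arccos hx.1 hx.2] at h
  linarith [mul_le_mul_of_nonneg_left h (hw0 i j)]

/-- For a weighted graph `G` on `n` vertices with total edge weight `W`, an
optimal GW SDP solution `X*`, a random subset `S_t` keeping each vertex independently with
probability `t/n`, and `ε_SDP = ((n−t)/(n²t))·(SDP(G) − W/2)`, the expected GW cut density on
the full graph satisfies
`(0.878/t²)·E[SDP(G[S_t])] − 0.878·ε_SDP ≤ (1/n²)·E[Cut(round(X*);G)] ≤ (1/t²)·E[SDP(G[S_t])]`. -/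
theorem stmt18 {n : ℕ} (hn : 0 < n) (w : Matrix (Fin n) (Fin n) ℝ)
    (hw : IsWeightedGraph w) (t : ℝ) (ht : 0 < t) (htn : t ≤ n)
    (Xstar : Matrix (Fin n) (Fin n) ℝ) (hpsd : Xstar.PosSemidef)
    (hdiag : ∀ i, Xstar i i = 1) (hoptX : (1 / 4) * (lap w * Xstar).trace = sdpVal w) :
    (0.878 / t ^ 2) * esdp w (t / n) -
        0.878 * ((((n : ℝ) - t) / ((n : ℝ) ^ 2 * t)) * (sdpVal w - totalW w / 2)) ≤
      (1 / (n : ℝ) ^ 2) * ecut w Xstar ∧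
    (1 / (n : ℝ) ^ 2) * ecut w Xstar ≤ (1 / t ^ 2) * esdp w (t / n) := by
  obtain ⟨p, rfl⟩ : ∃ p, t = p * n := ⟨t / n, by field_simp⟩
  have hn' : (0 : ℝ) < n := Nat.cast_pos.2 hn
  have hp0 : 0 < p := pos_of_mul_pos_left ht hn'.le
  have hp1 : p ≤ 1 := le_of_mul_le_mul_right (by linarith) hn'
  have h1 := sq_mul_sdpVal_le_esdp hw hp0.le hp1 hpsd hdiag hoptX
  have h2 := esdp_le hw hp0 hp1
  have h3 := ecut_le_sdpVal hw.2.1 hw.2.2 hpsd hdiag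
  have h4 := cut_value_le_ecut hw.2.1 hpsd hdiag
  rw [← quarter_trace_lap_mul hw.2.2 hpsd hdiag, hoptX] at h4
  rw [mul_div_cancel_right₀ p hn'.ne']
  constructor
  · calc _ = 0.878 * (esdp w p - p * (1 - p) * (sdpVal w - totalW w / 2)) / (p * n) ^ 2 := by
          field_simp
      _ ≤ 0.878 * (p ^ 2 * sdpVal w) / (p * n) ^ 2 := by
          gcongr
          linarith
      _ = 1 / (n : ℝ) ^ 2 * (0.878 * sdpVal w) := by field_simp
      _ ≤ _ := by gcongr
  · calc _ ≤ 1 / (n : ℝ) ^ 2 * sdpVal w := by gcongr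
      _ = 1 / (p * n) ^ 2 * (p ^ 2 * sdpVal w) := by field_simp
      _ ≤ _ := by gcongr
end
end
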